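/- arXiv:2511.23363 — 3 statements merged into one kernel-verified Lean document; each statement's English description precedes it below -/
import Mathlib

section
/- Let (G,+) and (H,⊕) be finite groups, let σ̄ = (σ_1,…,σ_k) ∈ {+1,−1}^k be a fixed sign sequence with k ≥ 2, let f : G → H be a function, and let g : G → H be a homomorphism with dist(f,g) = ε_f. For j ∈ {k−1, k}, let p_j be the fraction of tuples x ∈ G^j with ⊕_{i=1}^{j} σ_i f(x_i) = ⊕_{i=1}^{j} σ_i g(x_i). Then p_k ≤ max{ p_{k−1} , 1/2 + ε_f }. -/
/-- Apply a sign to a group element: `true` is `+` (identity), `false` is `-` (inverse). -/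
def applySign {G : Type*} [Group G] (b : Bool) (g : G) : G := if b then g else g⁻¹

/-- Signed product `σ₁x₁ ⋯ σₖxₖ`, taken in increasing index order. -/
def sProd {G : Type*} [Group G] {k : ℕ} (σ : Fin k → Bool) (x : Fin k → G) : G :=
  (List.ofFn fun i => applySign (σ i) (x i)).prod

/-- Relative Hamming distance between two functions on a finite domain. -/
noncomputable def hdist {G H : Type*} [Fintype G] (f g : G → H) : ℝ :=
  (Nat.card {x : G // f x ≠ g x} : ℝ) / (Fintype.card G : ℝ)

/-- Distance from `f` to the set of group homomorphisms `G →* H`. -/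
noncomputable def epsF {G H : Type*} [Fintype G] [Group G] [Group H] (f : G → H) : ℝ :=
  sInf (Set.range fun h : G →* H => hdist f ⇑h)

theorem applySign_inj {G : Type*} [Group G] (b : Bool) {x y : G} :
    applySign b x = applySign b y ↔ x = y := by
  cases b <;> simp [applySign]

theorem sProd_succ {G : Type*} [Group G] {n : ℕ} (σ : Fin (n + 1) → Bool) (x : Fin (n + 1) → G) :
    sProd σ x =
      sProd (fun i => σ i.castSucc) (fun i => x i.castSucc) *
        applySign (σ (Fin.last n)) (x (Fin.last n)) := by
  simp only [sProd, List.ofFn_succ', List.concat_eq_append, List.prod_append, List.prod_singleton]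

open Classical in
theorem natCard_subtype_eq_sum {α : Type*} [Fintype α] (p : α → Prop) :
    (Nat.card {x // p x} : ℝ) = ∑ x, if p x then (1 : ℝ) else 0 := by
  simp [Nat.card_eq_fintype_card, Fintype.card_subtype]

/-- Conditioning on whether the first `n` coordinates already agree bounds the number of
agreements of the signed products in `n + 1` variables. -/
theorem card_sProd_eq_succ_le {G H : Type*} [Group H] [Fintype G] {n : ℕ}
    (σ : Fin (n + 1) → Bool) (f g : G → H) :
    (Nat.card {x : Fin (n + 1) → G //
        sProd σ (fun i => f (x i)) = sProd σ (fun i => g (x i))} : ℝ) ≤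
      (Nat.card {x : Fin n → G //
          sProd (fun i => σ i.castSucc) (fun i => f (x i)) =
            sProd (fun i => σ i.castSucc) (fun i => g (x i))} : ℝ) *
          ((Fintype.card G : ℝ) - Nat.card {x : G // f x ≠ g x}) +
        ((Nat.card (Fin n → G) : ℝ) -
          Nat.card {x : Fin n → G //
            sProd (fun i => σ i.castSucc) (fun i => f (x i)) =
              sProd (fun i => σ i.castSucc) (fun i => g (x i))}) *
          Nat.card {x : G // f x ≠ g x} := by
  classical
  have hT : (Nat.card (Fin n → G) : ℝ) = ∑ _y : Fin n → G, (1 : ℝ) := by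
    rw [Nat.card_eq_fintype_card]; simp only [Finset.sum_const, Finset.card_univ, nsmul_eq_mul,
      mul_one]
  have hG : (Fintype.card G : ℝ) = ∑ _y : G, (1 : ℝ) := by simp
  rw [hT, natCard_subtype_eq_sum, natCard_subtype_eq_sum (α := Fin n → G),
    ← (Fin.snocEquiv fun _ => G).sum_comp, Fintype.sum_prod_type_right,
    ← Finset.sum_sub_distrib, Finset.sum_mul, Finset.sum_mul, ← Finset.sum_add_distrib]
  refine Finset.sum_le_sum fun y _ => ?_
  rw [hG, natCard_subtype_eq_sum, ← Finset.sum_sub_distrib, Finset.mul_sum, Finset.mul_sum,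
    ← Finset.sum_add_distrib]
  refine Finset.sum_le_sum fun z _ => ?_
  simp only [sProd_succ, Fin.snocEquiv_apply, Fin.snoc_castSucc, Fin.snoc_last]
  by_cases hy : sProd (fun i => σ i.castSucc) (fun i => f (y i)) =
      sProd (fun i => σ i.castSucc) (fun i => g (y i))
  · by_cases hz : f z = g z <;> simp [hy, hz, applySign_inj]
  · by_cases hz : f z = g z
    · simp [hy, hz]
    · simp only [hy, hz, ne_eq, not_false_eq_true, if_true, if_false]
      split_ifs <;> norm_num

/-- Mixing weights `p` and `1 - p` between `1 - e` and `e`. -/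
theorem mul_one_sub_add_le_max {p e : ℝ} (hp : 0 ≤ p) (he : 0 ≤ e) :
    p * (1 - e) + (1 - p) * e ≤ max p (1 / 2 + e) := by
  rcases le_total p (1 / 2) with h | h
  · exact le_max_of_le_right (by nlinarith [mul_nonneg hp he])
  · exact le_max_of_le_left (by nlinarith [mul_nonneg he (sub_nonneg.2 h)])

theorem stmt4 {G H : Type*} [Group G] [Group H] [Fintype G] [Fintype H]
    (k : ℕ) (hk : 2 ≤ k) (σ : Fin k → Bool)
    (f : G → H) (g : G →* H) (hg : hdist f ⇑g = epsF f) :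
    (Nat.card {x : Fin k → G //
        sProd σ (fun i => f (x i)) = sProd σ (fun i => g (x i))} : ℝ) /
      (Nat.card (Fin k → G) : ℝ) ≤
    max
      ((Nat.card {x : Fin (k - 1) → G //
          sProd (fun i => σ (Fin.castLE (Nat.sub_le k 1) i)) (fun i => f (x i)) =
            sProd (fun i => σ (Fin.castLE (Nat.sub_le k 1) i)) (fun i => g (x i))} : ℝ) /
        (Nat.card (Fin (k - 1) → G) : ℝ))
      (1 / 2 + epsF f) := by
  obtain ⟨n, rfl⟩ : ∃ n, k = n + 1 := ⟨k - 1, by omega⟩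
  rw [← hg]
  have hT : (0 : ℝ) < Nat.card (Fin n → G) := by exact_mod_cast Nat.card_pos
  have hG : (0 : ℝ) < Fintype.card G := by exact_mod_cast Fintype.card_pos
  have hTG : (Nat.card (Fin (n + 1) → G) : ℝ) = Nat.card (Fin n → G) * Fintype.card G := by
    simp [Nat.card_eq_fintype_card, pow_succ]
  refine le_trans ?_ (mul_one_sub_add_le_max (by positivity) (by unfold hdist; positivity))
  rw [hTG, div_le_iff₀ (mul_pos hT hG)]
  refine (card_sProd_eq_succ_le σ f g).trans (le_of_eq ?_)
  simp only [hdist]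
  change _ = (_ / (Nat.card (Fin n → G) : ℝ) * _ + (1 - _ / (Nat.card (Fin n → G) : ℝ)) * _) * _
  field_simp
  exact congrArg (· + _) (mul_comm _ _)
end

section
/- Let (G,+) be a finite group, let k ≥ 1, let a ∈ G, and let S ⊆ {1,…,2k} be a set of indices of size |S| = k. Then for every z ∈ G, the number of tuples (σ,x) ∈ F_a whose partial signed sum Σ_{i∈S} σ_i x_i (taken in increasing index order over S) equals z is exactly |F_a| / |G|. In particular, if (σ,x) is drawn uniformly from F_a, then Σ_{i∈S} σ_i x_i is uniformly distributed over G. -/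
/-- Partial signed product over a subset `S` of the indices, in increasing index order. -/
def sProdOn {G : Type*} [Group G] {m : ℕ} (S : Finset (Fin m))
    (σ : Fin m → Bool) (x : Fin m → G) : G :=
  ((S.sort (· ≤ ·)).map fun i => applySign (σ i) (x i)).prod

@[simp]
theorem applySign_applySign {G : Type*} [Group G] (b : Bool) (g : G) :
    applySign b (applySign b g) = g := by
  cases b <;> simp [applySign]

/-- If every point is moved by exactly one member of a `G`-indexed family of permutations into the
fibre of `P` over `z`, then this fibre has density `1 / |G|`. -/
theorem card_fiber_mul_card_of_bijective {X G : Type*} (e : G → Equiv.Perm X) (P : X → G)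
    (h : ∀ x, Function.Bijective fun g => P (e g x)) (z : G) :
    Nat.card {x // P x = z} * Nat.card G = Nat.card X := by
  rw [← Nat.card_prod]
  refine Nat.card_congr (Equiv.ofBijective (fun q => (e q.2).symm q.1.1) ⟨?_, fun x => ?_⟩)
  · rintro ⟨⟨y, hy⟩, g⟩ ⟨⟨y', hy'⟩, g'⟩ heq
    have heq' : (e g).symm y = (e g').symm y' := heq
    have hg : g = g' := (h ((e g).symm y)).1 (by
      change P (e g ((e g).symm y)) = P (e g' ((e g).symm y))
      rw [Equiv.apply_symm_apply, heq', Equiv.apply_symm_apply, hy, hy'])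
    subst hg
    have : y = y' := (e g).symm.injective heq'
    subst this
    rfl
  · obtain ⟨g, hg⟩ := (h x).2 z
    exact ⟨⟨⟨e g x, hg⟩, g⟩, (e g).symm_apply_apply x⟩

/-- A list on which a predicate is not constant has two consecutive entries separated by it. -/
theorem List.exists_consecutive_of_not_constant {α : Type*} (p : α → Prop) :
    ∀ {l : List α} {a b : α}, a ∈ l → b ∈ l → p a → ¬ p b →
      ∃ l₁ l₂ i j, l = l₁ ++ i :: j :: l₂ ∧ ¬ (p i ↔ p j)
  | [], _, _, ha, _, _, _ => absurd ha List.not_mem_nil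
  | [c], a, b, ha, hb, hpa, hpb => by simp_all
  | c :: d :: l, a, b, ha, hb, hpa, hpb => by
    by_cases hcd : p c ↔ p d
    · have key : ∀ q : α → Prop, (q c → q d) → (∀ x ∈ c :: d :: l, q x → ∃ y ∈ d :: l, q y) := by
        intro q hq x hx hqx
        rcases List.mem_cons.1 hx with rfl | hx
        · exact ⟨d, by simp, hq hqx⟩
        · exact ⟨x, hx, hqx⟩
      obtain ⟨a', ha', hpa'⟩ := key p hcd.1 a ha hpa
      obtain ⟨b', hb', hpb'⟩ := key (fun x => ¬ p x) (mt hcd.2) b hb hpb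
      obtain ⟨l₁, l₂, i, j, hl, hij⟩ :=
        List.exists_consecutive_of_not_constant p ha' hb' hpa' hpb'
      exact ⟨c :: l₁, l₂, i, j, by rw [hl, List.cons_append], hij⟩
    · exact ⟨[], l, c, d, rfl, hcd⟩

/-- Apply a permutation of the group to each signed entry. -/
def signedPerm {G ι : Type*} [Group G] (φ : ι → Equiv.Perm G) :
    Equiv.Perm ((ι → Bool) × (ι → G)) where
  toFun p := (p.1, fun t => applySign (p.1 t) (φ t (applySign (p.1 t) (p.2 t))))
  invFun p := (p.1, fun t => applySign (p.1 t) ((φ t).symm (applySign (p.1 t) (p.2 t))))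
  left_inv p := by simp
  right_inv p := by simp

/-- Multiply entry `i` by `g` on the right and entry `j` by `g⁻¹` on the left. -/
def shear {G ι : Type*} [Group G] [DecidableEq ι] (i j : ι) (g : G) (t : ι) : Equiv.Perm G :=
  if t = i then Equiv.mulRight g else if t = j then Equiv.mulLeft g⁻¹ else 1

theorem map_shear_of_notMem {G ι : Type*} [Group G] [DecidableEq ι] {i j : ι} (g : G)
    (y : ι → G) {l : List ι} (hi : i ∉ l) (hj : j ∉ l) :
    l.map (fun t => shear i j g t (y t)) = l.map y := by
  refine List.map_congr_left fun t ht => ?_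
  have h₁ : t ≠ i := fun h => hi (h ▸ ht)
  have h₂ : t ≠ j := fun h => hj (h ▸ ht)
  simp [shear, h₁, h₂]

theorem prod_map_shear {G ι : Type*} [Group G] [DecidableEq ι] {i j : ι} (g : G)
    (y : ι → G) {l₁ l₂ : List ι} (h : (l₁ ++ i :: j :: l₂).Nodup) :
    ((l₁ ++ i :: j :: l₂).map fun t => shear i j g t (y t)).prod
      = ((l₁ ++ i :: j :: l₂).map y).prod := by
  have h' := h
  simp only [List.nodup_append, List.nodup_cons, List.mem_cons, not_or] at h'
  obtain ⟨-, ⟨⟨hij, hi₂⟩, hj₂, -⟩, hd⟩ := h'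
  have hi₁ : i ∉ l₁ := fun hm => hd i hm i (Or.inl rfl) rfl
  have hj₁ : j ∉ l₁ := fun hm => hd j hm j (Or.inr (Or.inl rfl)) rfl
  simp only [List.map_append, List.map_cons, map_shear_of_notMem g y hi₁ hj₁,
    map_shear_of_notMem g y hi₂ hj₂]
  simp [shear, Ne.symm hij, mul_assoc]

theorem bijective_prod_map_shear {G ι : Type*} [Group G] [DecidableEq ι] {i j : ι}
    (y : ι → G) {l : List ι} (hl : l.Nodup) (hij : ¬ (i ∈ l ↔ j ∈ l)) :
    Function.Bijective fun g : G => (l.map fun t => shear i j g t (y t)).prod := by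
  have split : ∀ c ∈ l, ∃ s t, l = s ++ c :: t ∧ c ∉ s ∧ c ∉ t := by
    intro c hc
    obtain ⟨s, t, rfl⟩ := List.append_of_mem hc
    simp only [List.nodup_append, List.nodup_cons, List.mem_cons] at hl
    exact ⟨s, t, rfl, fun hm => hl.2.2 c hm c (Or.inl rfl) rfl, hl.2.1.1⟩
  have hne : i ≠ j := fun h => hij (by rw [h])
  by_cases hi : i ∈ l
  · have hj : j ∉ l := fun hj => hij (iff_of_true hi hj)
    obtain ⟨s, t, rfl, his, hit⟩ := split i hi
    simp only [List.mem_append, List.mem_cons, not_or] at hj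
    have : (fun g : G => ((s ++ i :: t).map fun u => shear i j g u (y u)).prod) =
        ((Equiv.mulRight (t.map y).prod).trans
          (Equiv.mulLeft ((s.map y).prod * y i)) : G ≃ G) := by
      funext g
      simp only [List.map_append, List.map_cons, map_shear_of_notMem g y his hj.1,
        map_shear_of_notMem g y hit hj.2.2]
      simp [shear, mul_assoc]
    rw [this]
    exact Equiv.bijective _
  · have hj : j ∈ l := by tauto
    obtain ⟨s, t, rfl, hjs, hjt⟩ := split j hj
    simp only [List.mem_append, List.mem_cons, not_or] at hi
    have : (fun g : G => ((s ++ j :: t).map fun u => shear i j g u (y u)).prod) =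
        (((Equiv.inv G).trans (Equiv.mulRight (y j * (t.map y).prod))).trans
          (Equiv.mulLeft (s.map y).prod) : G ≃ G) := by
      funext g
      simp only [List.map_append, List.map_cons, map_shear_of_notMem g y hi.1 hjs,
        map_shear_of_notMem g y hi.2.2 hjt]
      simp [shear, Ne.symm hne, mul_assoc]
    rw [this]
    exact Equiv.bijective _

theorem stmt11 {G : Type*} [Group G] [Fintype G]
    (k : ℕ) (hk : 1 ≤ k) (a : G) (S : Finset (Fin (2 * k))) (hS : S.card = k)
    (z : G) :
    Nat.card {p : (Fin (2 * k) → Bool) × (Fin (2 * k) → G) //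
        sProd p.1 p.2 = a ∧ sProdOn S p.1 p.2 = z} * Fintype.card G
      = Nat.card {p : (Fin (2 * k) → Bool) × (Fin (2 * k) → G) //
          sProd p.1 p.2 = a} := by
  obtain ⟨c, hc⟩ : S.Nonempty := Finset.card_pos.1 (by omega)
  obtain ⟨d, hd⟩ : ∃ d, d ∉ S := by
    by_contra! h
    rw [Finset.eq_univ_iff_forall.2 h, Finset.card_univ, Fintype.card_fin] at hS
    omega
  obtain ⟨l₁, l₂, i, j, hl, hij⟩ := List.exists_consecutive_of_not_constant (· ∈ S)
    (List.mem_finRange c) (List.mem_finRange d) hc hd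
  have hprod : ∀ g (p : (Fin (2 * k) → Bool) × (Fin (2 * k) → G)),
      sProd (signedPerm (shear i j g) p).1 (signedPerm (shear i j g) p).2
        = sProd p.1 p.2 := by
    intro g p
    simp only [sProd, List.ofFn_eq_map, signedPerm, Equiv.coe_fn_mk, applySign_applySign, hl]
    exact prod_map_shear g (fun t => applySign (p.1 t) (p.2 t)) (hl ▸ List.nodup_finRange _)
  have h := card_fiber_mul_card_of_bijective
    (X := {p : (Fin (2 * k) → Bool) × (Fin (2 * k) → G) // sProd p.1 p.2 = a})
    (fun g : G => (signedPerm (shear i j g)).subtypePerm fun p => by rw [hprod])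
    (fun p => sProdOn S p.1.1 p.1.2) (fun p => by
      simp only [sProdOn, signedPerm, Equiv.Perm.subtypePerm_apply, Equiv.coe_fn_mk,
        applySign_applySign]
      exact bijective_prod_map_shear (fun t => applySign (p.1.1 t) (p.1.2 t))
        (S.sort_nodup _) (by simpa using hij)) z
  rw [← h, Nat.card_eq_fintype_card (α := G)]
  congr 1
  exact Nat.card_congr (Equiv.subtypeSubtypeEquivSubtypeInter _ _).symm
end

section
/- Let (G,+) be a finite group and let m ≥ 1. Then the fraction of tuples X = (x_1,…,x_m) ∈ G^m for which there exist a sign sequence σ ∈ {+1,−1}^m and two distinct subsets S_1 ≠ S_2 of {1,…,m} with Σ_{j∈S_1} σ_j x_j = Σ_{j∈S_2} σ_j x_j (each partial signed sum taken in increasing index order) is at most 2^{3m} / |G|. In particular, if 2^m ≤ |G|^{1/4}, this fraction is at most 1/2^m. -/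
theorem applySign_injective {G : Type*} [Group G] (b : Bool) :
    Function.Injective (applySign (G := G) b) := by
  cases b <;> simp [applySign, Function.Injective]

theorem sProdOn_congr {G : Type*} [Group G] {m : ℕ} {S : Finset (Fin m)} (σ : Fin m → Bool)
    {X Y : Fin m → G} (h : ∀ i ∈ S, X i = Y i) : sProdOn S σ X = sProdOn S σ Y := by
  unfold sProdOn
  congr 1
  refine List.map_congr_left fun i hi => ?_
  rw [h i ((Finset.mem_sort _).1 hi)]

/-- If two tuples agree off an index `j ∈ S`, the partial signed product over `S`
determines the entry at `j`. -/
theorem eq_of_sProdOn_eq {G : Type*} [Group G] {m : ℕ} {S : Finset (Fin m)} {j : Fin m}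
    (hj : j ∈ S) (σ : Fin m → Bool) {X Y : Fin m → G} (h : ∀ i, i ≠ j → X i = Y i)
    (hXY : sProdOn S σ X = sProdOn S σ Y) : X = Y := by
  obtain ⟨l₁, l₂, hl⟩ := List.append_of_mem ((Finset.mem_sort (· ≤ ·)).2 hj)
  have hn : (l₁ ++ j :: l₂).Nodup := hl ▸ S.sort_nodup (· ≤ ·)
  rw [List.nodup_middle, List.nodup_cons, List.mem_append, not_or] at hn
  have hcongr : ∀ l : List (Fin m), j ∉ l →
      (l.map fun i => applySign (σ i) (X i)) = l.map fun i => applySign (σ i) (Y i) := by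
    intro l hjl
    refine List.map_congr_left fun i hi => ?_
    rw [h i (ne_of_mem_of_not_mem hi hjl)]
  unfold sProdOn at hXY
  rw [hl, List.map_append, List.map_append, List.map_cons, List.map_cons, List.prod_append,
    List.prod_append, List.prod_cons, List.prod_cons, hcongr l₁ hn.1.1, hcongr l₂ hn.1.2] at hXY
  have hXYj := applySign_injective _ (mul_right_cancel (mul_left_cancel hXY))
  funext i
  by_cases hi : i = j
  · rw [hi, hXYj]
  · exact h i hi

/-- Tuples with a prescribed collision have density at most `1 / |G|`. -/
theorem card_collision_mul_card_le {G : Type*} [Group G] [Fintype G] {m : ℕ}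
    (σ : Fin m → Bool) {S₁ S₂ : Finset (Fin m)} (hS : S₁ ≠ S₂) :
    {X : Fin m → G | sProdOn S₁ σ X = sProdOn S₂ σ X}.ncard * Nat.card G ≤
      Nat.card (Fin m → G) := by
  wlog hsub : ¬ S₁ ⊆ S₂ generalizing S₁ S₂
  · have hsub' : ¬ S₂ ⊆ S₁ := fun h => hS (subset_antisymm (not_not.1 hsub) h)
    simpa only [eq_comm] using this hS.symm hsub'
  obtain ⟨j, hj₁, hj₂⟩ := Finset.not_subset.1 hsub
  rw [← Nat.card_coe_set_eq, ← Nat.card_prod]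
  refine Nat.card_le_card_of_injective
    (fun p : {X : Fin m → G | sProdOn S₁ σ X = sProdOn S₂ σ X} × G =>
      Function.update p.1.1 j p.2) ?_
  rintro ⟨⟨X, hX⟩, g⟩ ⟨⟨Y, hY⟩, g'⟩ h
  have hoff : ∀ i, i ≠ j → X i = Y i := fun i hi => by simpa [hi] using congrFun h i
  have hg : g = g' := by simpa using congrFun h j
  have hXY : sProdOn S₁ σ X = sProdOn S₁ σ Y := by
    rw [hX.out, hY.out]
    exact sProdOn_congr σ fun i hi => hoff i (ne_of_mem_of_not_mem hi hj₂)
  have hXY' : X = Y := eq_of_sProdOn_eq hj₁ σ hoff hXY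
  subst hg hXY'
  rfl

theorem card_exists_collision_mul_card_le {G : Type*} [Group G] [Fintype G] (m : ℕ) :
    Nat.card {X : Fin m → G // ∃ (σ : Fin m → Bool) (S₁ S₂ : Finset (Fin m)),
        S₁ ≠ S₂ ∧ sProdOn S₁ σ X = sProdOn S₂ σ X} * Nat.card G ≤
      2 ^ (3 * m) * Nat.card (Fin m → G) := by
  classical
  let T : (Fin m → Bool) × Finset (Fin m) × Finset (Fin m) → Set (Fin m → G) := fun p =>
    {X | p.2.1 ≠ p.2.2 ∧ sProdOn p.2.1 p.1 X = sProdOn p.2.2 p.1 X}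
  have hT : ∀ p, (T p).ncard * Nat.card G ≤ Nat.card (Fin m → G) := by
    rintro ⟨σ, S₁, S₂⟩
    by_cases hS : S₁ = S₂
    · simp [T, hS]
    · simpa [T, hS] using card_collision_mul_card_le (G := G) σ hS
  have hunion : {X : Fin m → G | ∃ (σ : Fin m → Bool) (S₁ S₂ : Finset (Fin m)),
      S₁ ≠ S₂ ∧ sProdOn S₁ σ X = sProdOn S₂ σ X} = ⋃ p, T p := by
    ext X
    simp [T, Prod.exists]
  calc
    _ = (⋃ p, T p).ncard * Nat.card G := by rw [← hunion]; rfl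
    _ ≤ (∑ p, (T p).ncard) * Nat.card G := by
      gcongr
      exact Set.ncard_iUnion_le_of_fintype T
    _ = ∑ p, (T p).ncard * Nat.card G := Finset.sum_mul ..
    _ ≤ ∑ _p : (Fin m → Bool) × Finset (Fin m) × Finset (Fin m), Nat.card (Fin m → G) :=
      Finset.sum_le_sum fun p _ => hT p
    _ = 2 ^ (3 * m) * Nat.card (Fin m → G) := by
      rw [Finset.sum_const, Finset.card_univ, smul_eq_mul]
      congr 1
      simp only [Fintype.card_prod, Fintype.card_finset, Fintype.card_fun, Fintype.card_bool,
        Fintype.card_fin]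
      ring

theorem stmt14 {G : Type*} [Group G] [Fintype G] (m : ℕ) (hm : 1 ≤ m) :
    (Nat.card {X : Fin m → G // ∃ (σ : Fin m → Bool) (S₁ S₂ : Finset (Fin m)),
        S₁ ≠ S₂ ∧ sProdOn S₁ σ X = sProdOn S₂ σ X} : ℝ) /
      (Nat.card (Fin m → G) : ℝ) ≤ 2 ^ (3 * m) / (Fintype.card G : ℝ) ∧
    ((2 : ℝ) ^ m ≤ (Fintype.card G : ℝ) ^ ((1 : ℝ) / 4) →
      (Nat.card {X : Fin m → G // ∃ (σ : Fin m → Bool) (S₁ S₂ : Finset (Fin m)),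
          S₁ ≠ S₂ ∧ sProdOn S₁ σ X = sProdOn S₂ σ X} : ℝ) /
        (Nat.card (Fin m → G) : ℝ) ≤ 1 / 2 ^ m) := by
  have hG : (0 : ℝ) < Fintype.card G := by exact_mod_cast Fintype.card_pos
  have hbound : (Nat.card {X : Fin m → G // ∃ (σ : Fin m → Bool) (S₁ S₂ : Finset (Fin m)),
        S₁ ≠ S₂ ∧ sProdOn S₁ σ X = sProdOn S₂ σ X} : ℝ) /
      (Nat.card (Fin m → G) : ℝ) ≤ 2 ^ (3 * m) / (Fintype.card G : ℝ) := by
    rw [div_le_div_iff₀ (by exact_mod_cast Nat.card_pos) hG]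
    have := card_exists_collision_mul_card_le (G := G) m
    rw [Nat.card_eq_fintype_card (α := G)] at this
    exact_mod_cast this
  refine ⟨hbound, fun h => hbound.trans ?_⟩
  rw [div_le_div_iff₀ hG (by positivity), one_mul]
  calc
    (2 : ℝ) ^ (3 * m) * 2 ^ m = (2 ^ m) ^ 4 := by ring
    _ ≤ ((Fintype.card G : ℝ) ^ ((1 : ℝ) / 4)) ^ 4 := by gcongr
    _ = Fintype.card G := by
      rw [← Real.rpow_mul_natCast hG.le]
      norm_num
end
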